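/- arXiv:2405.10392 — 2 statements merged into one kernel-verified Lean document; each statement's English description precedes it below -/
import Mathlib

section
/- Let n ≥ 1, γ ∈ ℝ, A the Landau collision kernel on ℝ^d, s : ℝ^d → ℝ^d, Δt > 0. For a configuration of points X_1, …, X_n define v(X_i) = −(1/n) ∑_{j=1}^n A(X_i − X_j)(s(X_i) − s(X_j)), and for a sequence of configurations (X_1^k, …, X_n^k), k = 1, 2, …, define the estimated entropy E^k = (Δt/n) ∑_{m=1}^k ∑_{i=1}^n ⟨s(X_i^m), v(X_i^m)⟩. Then the estimated entropy is nonincreasing: for every k, E^{k+1} − E^k = −(Δt/(2n²)) ∑_{i,j=1}^n ⟨s(X_i^{k+1}) − s(X_j^{k+1}), A(X_i^{k+1} − X_j^{k+1})(s(X_i^{k+1}) − s(X_j^{k+1}))⟩ ≤ 0. -/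
open MeasureTheory
open scoped RealInnerProductSpace

/-- The Landau collision kernel with parameter `γ`, acting on vectors:
`A(z)w = |z|^γ (|z|² w − ⟨z,w⟩ z)`. -/
noncomputable def landauA (d : ℕ) (γ : ℝ) (z w : EuclideanSpace ℝ (Fin d)) :
    EuclideanSpace ℝ (Fin d) :=
  ‖z‖ ^ γ • (‖z‖ ^ 2 • w - ⟪z, w⟫ • z)

theorem landauA_neg_neg' (d : ℕ) (γ : ℝ) (z w : EuclideanSpace ℝ (Fin d)) :
    landauA d γ (-z) (-w) = - landauA d γ z w := by
  simp only [landauA, norm_neg, inner_neg_neg]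
  module

theorem landauA_inner_nonneg (d : ℕ) (γ : ℝ) (z w : EuclideanSpace ℝ (Fin d)) :
    0 ≤ ⟪w, landauA d γ z w⟫ := by
  simp only [landauA, inner_smul_right, inner_sub_right, real_inner_self_eq_norm_sq]
  apply mul_nonneg (Real.rpow_nonneg (norm_nonneg _) _)
  have h := real_inner_mul_inner_self_le z w
  rw [real_inner_self_eq_norm_sq, real_inner_self_eq_norm_sq] at h
  rw [real_inner_comm z w]
  linarith

/-- The estimated entropy `E^k = (Δt/n) ∑_{m=1}^k ∑ᵢ ⟨s(Xᵢ^m), v(Xᵢ^m)⟩`, with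
`v(Xᵢ) = −(1/n) ∑ⱼ A(Xᵢ−Xⱼ)(s(Xᵢ)−s(Xⱼ))`, is nonincreasing:
`E^{k+1} − E^k = −(Δt/(2n²)) ∑_{i,j} ⟨s(Xᵢ^{k+1})−s(Xⱼ^{k+1}),
A(Xᵢ^{k+1}−Xⱼ^{k+1})(s(Xᵢ^{k+1})−s(Xⱼ^{k+1}))⟩ ≤ 0`. -/
theorem estimated_entropy_decay (d n : ℕ) (hn : 1 ≤ n) (γ : ℝ)
    (s : EuclideanSpace ℝ (Fin d) → EuclideanSpace ℝ (Fin d))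
    (Δt : ℝ) (hΔt : 0 < Δt)
    (X : ℕ → Fin n → EuclideanSpace ℝ (Fin d))
    (v : (Fin n → EuclideanSpace ℝ (Fin d)) → Fin n → EuclideanSpace ℝ (Fin d))
    (hv : ∀ Y i, v Y i = -(1 / (n : ℝ)) • ∑ j, landauA d γ (Y i - Y j) (s (Y i) - s (Y j)))
    (Ent : ℕ → ℝ)
    (hEnt : ∀ k, Ent k = (Δt / (n : ℝ)) * ∑ m ∈ Finset.Icc 1 k, ∑ i, ⟪s (X m i), v (X m) i⟫)
    (k : ℕ) :
    (Ent (k + 1) - Ent k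
        = -(Δt / (2 * (n : ℝ) ^ 2)) * ∑ i, ∑ j,
            ⟪s (X (k + 1) i) - s (X (k + 1) j),
              landauA d γ (X (k + 1) i - X (k + 1) j)
                (s (X (k + 1) i) - s (X (k + 1) j))⟫) ∧
    Ent (k + 1) - Ent k ≤ 0 := by
  have key : Ent (k + 1) - Ent k
        = -(Δt / (2 * (n : ℝ) ^ 2)) * ∑ i, ∑ j,
            ⟪s (X (k + 1) i) - s (X (k + 1) j),
              landauA d γ (X (k + 1) i - X (k + 1) j)
                (s (X (k + 1) i) - s (X (k + 1) j))⟫ := by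
    rw [hEnt, hEnt, Finset.sum_Icc_succ_top (by omega), mul_add, add_sub_cancel_left]
    generalize X (k + 1) = Y
    have hA : ∀ i j, landauA d γ (Y j - Y i) (s (Y j) - s (Y i))
        = - landauA d γ (Y i - Y j) (s (Y i) - s (Y j)) := by
      intro i j
      rw [← landauA_neg_neg', neg_sub, neg_sub]
    have h1 : ∑ i, ⟪s (Y i), v Y i⟫ = -(1 / (n : ℝ)) * ∑ i, ∑ j,
        ⟪s (Y i), landauA d γ (Y i - Y j) (s (Y i) - s (Y j))⟫ := by
      rw [Finset.mul_sum]
      refine Finset.sum_congr rfl fun i _ => ?_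
      rw [hv, inner_smul_right, inner_sum]
    have h2 : ∑ i, ∑ j, ⟪s (Y j), landauA d γ (Y i - Y j) (s (Y i) - s (Y j))⟫
        = - ∑ i, ∑ j, ⟪s (Y i), landauA d γ (Y i - Y j) (s (Y i) - s (Y j))⟫ := by
      rw [Finset.sum_comm, ← Finset.sum_neg_distrib]
      refine Finset.sum_congr rfl fun i _ => ?_
      rw [← Finset.sum_neg_distrib]
      refine Finset.sum_congr rfl fun j _ => ?_
      rw [hA i j, inner_neg_right]
    simp only [inner_sub_left, Finset.sum_sub_distrib]
    rw [h2, h1]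
    have : (n : ℝ) ≠ 0 := by positivity
    field_simp
    ring
  refine ⟨key, ?_⟩
  rw [key, neg_mul]
  refine neg_nonpos.mpr (mul_nonneg (by positivity) ?_)
  exact Finset.sum_nonneg fun i _ => Finset.sum_nonneg fun j _ => landauA_inner_nonneg _ _ _ _
end

section
/- Fix t and let u = u_t, u* = u*_t : ℝ^d → ℝ be continuously differentiable, everywhere positive probability densities with finite second moments, equal means V = ∫ x u dx = ∫ x u* dx and equal energies 2E = ∫ |x|² u dx = ∫ |x|² u* dx; let Σ_{ij} = ∫ x_i x_j u dx and Σ*_{ij} = ∫ x_i x_j u* dx. Let s : ℝ^d → ℝ^d, let A be the Maxwellian Landau kernel (γ = 0), and define v(x) = −∫ A(x−y)(s(x) − s(y)) u(y) dy and v*(x) = −∫ A(x−y)(∇ log u*(x) − ∇ log u*(y)) u*(y) dy. Suppose the map τ ↦ KL(u_τ‖u*_τ) is differentiable at t with derivative equal to ∫ ⟨v(x) − v*(x), ∇ log u(x) − ∇ log u*(x)⟩ u(x) dx, that the Fokker-Planck decompositions v*(x) = −(d−1)(x−V) − (A∗u*)(x) ∇ log u*(x) and v̄(x) := −∫ A(x−y)(∇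 log u(x) − ∇ log u(y)) u(y) dy = −(d−1)(x−V) − (A∗u)(x) ∇ log u(x) hold, and that all integrals below converge absolutely. Then (d/dt) KL(u_t‖u*_t) ≤ 2 ∫ |∇ log u − s|²_{A∗u} u dx + ∫ ⟨∇ log u*(x), (Σ − Σ*)(∇ log u(x) − ∇ log u*(x))⟩ u(x) dx. -/
open MeasureTheory
open scoped RealInnerProductSpace

/-- The score `∇ log u` of a positive density `u`. -/
noncomputable def score (d : ℕ) (u : EuclideanSpace ℝ (Fin d) → ℝ) :
    EuclideanSpace ℝ (Fin d) → EuclideanSpace ℝ (Fin d) :=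
  gradient fun x => Real.log (u x)

theorem landauA_zero (d : ℕ) (z w : EuclideanSpace ℝ (Fin d)) :
    landauA d 0 z w = ‖z‖ ^ 2 • w - ⟪z, w⟫ • z := by
  simp [landauA]

theorem landauA_inner (d : ℕ) (z w g : EuclideanSpace ℝ (Fin d)) :
    ⟪landauA d 0 z w, g⟫ = ‖z‖ ^ 2 * ⟪w, g⟫ - ⟪z, w⟫ * ⟪z, g⟫ := by
  rw [landauA_zero, inner_sub_left, real_inner_smul_left, real_inner_smul_left]

theorem landauA_sub (d : ℕ) (z w g : EuclideanSpace ℝ (Fin d)) :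
    landauA d 0 z (w - g) = landauA d 0 z w - landauA d 0 z g := by
  simp only [landauA_zero, inner_sub_right, smul_sub, sub_smul]
  abel

theorem landauA_psd (d : ℕ) (z w : EuclideanSpace ℝ (Fin d)) :
    0 ≤ ⟪landauA d 0 z w, w⟫ := by
  rw [landauA_inner, real_inner_self_eq_norm_sq]
  have h := abs_real_inner_le_norm z w
  have h2 : ⟪z, w⟫ ^ 2 ≤ (‖z‖ * ‖w‖) ^ 2 := by
    rw [← sq_abs]
    exact pow_le_pow_left₀ (abs_nonneg _) h 2
  nlinarith

theorem landauA_symm (d : ℕ) (z w g : EuclideanSpace ℝ (Fin d)) :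
    ⟪landauA d 0 z w, g⟫ = ⟪landauA d 0 z g, w⟫ := by
  rw [landauA_inner, landauA_inner, real_inner_comm]; ring

theorem landauA_young (d : ℕ) (z a b g : EuclideanSpace ℝ (Fin d)) :
    ⟪landauA d 0 z (a - b), g⟫ ≤ ⟪landauA d 0 z g, g⟫
      + (1/2) * ⟪landauA d 0 z a, a⟫ + (1/2) * ⟪landauA d 0 z b, b⟫ := by
  have h1 := landauA_psd d z ((a - b) - (2:ℝ) • g)
  have h2 := landauA_psd d z (a + b)
  simp only [landauA_inner, inner_sub_left, inner_sub_right, inner_add_left, inner_add_right,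
    real_inner_smul_left, real_inner_smul_right] at h1 h2 ⊢
  rw [real_inner_comm a b, real_inner_comm a g, real_inner_comm b g] at *
  nlinarith

theorem int_add' {d : ℕ} {f g : EuclideanSpace ℝ (Fin d) → ℝ} (hf : Integrable f)
    (hg : Integrable g) : Integrable fun x => f x + g x := hf.add hg

theorem int_sub' {d : ℕ} {f g : EuclideanSpace ℝ (Fin d) → ℝ} (hf : Integrable f)
    (hg : Integrable g) : Integrable fun x => f x - g x := hf.sub hg

section
variable {d : ℕ} {u : EuclideanSpace ℝ (Fin d) → ℝ}

theorem int_first (hc : Continuous u) (hpos : ∀ x, 0 < u x) (hi : Integrable u)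
    (hm : Integrable fun x => ‖x‖ ^ 2 * u x) : Integrable fun y => u y • y := by
  refine (hi.add hm).mono' (by fun_prop) (Filter.Eventually.of_forall fun y => ?_)
  have := hpos y
  rw [norm_smul, Real.norm_of_nonneg this.le]
  simp only [Pi.add_apply]
  nlinarith [mul_nonneg this.le (sq_nonneg (‖y‖ - 1)), mul_nonneg this.le (norm_nonneg y),
    mul_nonneg this.le (sq_nonneg (‖y‖))]

theorem int_second (hc : Continuous u) (hpos : ∀ x, 0 < u x)
    (hm : Integrable fun x => ‖x‖ ^ 2 * u x) (i j : Fin d) :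
    Integrable fun y : EuclideanSpace ℝ (Fin d) => y i * y j * u y := by
  refine hm.mono' (by fun_prop) (Filter.Eventually.of_forall fun y => ?_)
  rw [norm_mul, norm_mul, Real.norm_of_nonneg (hpos y).le, sq]
  have h1 := PiLp.norm_apply_le y i
  have h2 := PiLp.norm_apply_le y j
  have := (hpos y).le
  gcongr

theorem int_A (hc : Continuous u) (hpos : ∀ x, 0 < u x) (hi : Integrable u)
    (hm : Integrable fun x => ‖x‖ ^ 2 * u x) (x w : EuclideanSpace ℝ (Fin d)) :
    Integrable fun y => u y • landauA d 0 (x - y) w := by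
  simp only [landauA_zero]
  refine (((hi.const_mul (‖x‖ ^ 2)).add hm).const_mul (4 * ‖w‖)).mono' (by fun_prop)
    (Filter.Eventually.of_forall fun y => ?_)
  have hu := (hpos y).le
  rw [norm_smul, Real.norm_of_nonneg hu]
  simp only [Pi.add_apply]
  have h1 : ‖‖x - y‖ ^ 2 • w - ⟪x - y, w⟫ • (x - y)‖ ≤ 2 * ‖x - y‖ ^ 2 * ‖w‖ := by
    refine (norm_sub_le _ _).trans ?_
    rw [norm_smul, norm_smul]
    have := norm_inner_le_norm (𝕜 := ℝ) (x - y) w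
    have h3 := mul_le_mul_of_nonneg_right this (norm_nonneg (x - y))
    simp only [norm_pow, norm_norm]
    nlinarith
  have h2 : ‖x - y‖ ^ 2 ≤ 2 * (‖x‖ ^ 2 + ‖y‖ ^ 2) := by
    have := pow_le_pow_left₀ (norm_nonneg _) (norm_sub_le x y) 2
    nlinarith [sq_nonneg (‖x‖ - ‖y‖)]
  calc _ ≤ u y * (2 * (2 * (‖x‖ ^ 2 + ‖y‖ ^ 2)) * ‖w‖) := by
        refine mul_le_mul_of_nonneg_left (h1.trans ?_) hu
        gcongr
    _ = _ := by ring

theorem euc_inner_sum (y w : EuclideanSpace ℝ (Fin d)) : ⟪y, w⟫ = ∑ i, w i * y i := by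
  simp [PiLp.inner_apply]

theorem moment (hc : Continuous u) (hpos : ∀ x, 0 < u x) (hi : Integrable u)
    (h1 : ∫ x, u x = 1)
    (hm : Integrable fun x => ‖x‖ ^ 2 * u x) (x w g : EuclideanSpace ℝ (Fin d)) :
    ⟪∫ y, u y • landauA d 0 (x - y) w, g⟫ =
      (‖x‖ ^ 2 * ⟪w, g⟫ - ⟪x, w⟫ * ⟪x, g⟫) - 2 * ⟪w, g⟫ * ⟪x, ∫ y, u y • y⟫
        + ⟪w, g⟫ * (∫ y, ‖y‖ ^ 2 * u y) + ⟪x, w⟫ * ⟪g, ∫ y, u y • y⟫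
        + ⟪x, g⟫ * ⟪w, ∫ y, u y • y⟫
        - ∑ i, ∑ j, w i * (∫ y, y i * y j * u y) * g j := by
  have hf := int_first hc hpos hi hm
  have hs := int_second hc hpos hm
  have hin : ∀ a : EuclideanSpace ℝ (Fin d), Integrable fun y => ⟪a, u y • y⟫ :=
    fun a => hf.const_inner a
  rw [real_inner_comm, ← integral_inner (int_A hc hpos hi hm x w)]
  rw [← integral_inner hf, ← integral_inner hf, ← integral_inner hf]
  have hsum : ∑ i, ∑ j, w i * (∫ y, y i * y j * u y) * g j
      = ∫ y, ∑ i, ∑ j, w i * (y i * y j * u y) * g j := by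
    rw [integral_finsetSum]
    · refine Finset.sum_congr rfl fun i _ => ?_
      rw [integral_finsetSum]
      · refine Finset.sum_congr rfl fun j _ => ?_
        rw [integral_mul_const, integral_const_mul]
      · intro j _
        exact ((hs i j).const_mul _).mul_const _
    · intro i _
      exact integrable_finsetSum _ fun j _ => ((hs i j).const_mul _).mul_const _
  have hsi : Integrable fun y : EuclideanSpace ℝ (Fin d) =>
      ∑ i, ∑ j, w i * (y i * y j * u y) * g j :=
    integrable_finsetSum _ fun i _ => integrable_finsetSum _ fun j _ =>
      ((hs i j).const_mul _).mul_const _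
  have h0 : ‖x‖ ^ 2 * ⟪w, g⟫ - ⟪x, w⟫ * ⟪x, g⟫
      = ∫ y, (‖x‖ ^ 2 * ⟪w, g⟫ - ⟪x, w⟫ * ⟪x, g⟫) * u y := by
    rw [integral_const_mul, h1, mul_one]
  rw [hsum, h0, ← integral_const_mul, ← integral_const_mul, ← integral_const_mul,
    ← integral_const_mul]
  have i0 := hi.const_mul (‖x‖ ^ 2 * ⟪w, g⟫ - ⟪x, w⟫ * ⟪x, g⟫)
  have i1 := (hin x).const_mul (2 * ⟪w, g⟫)
  have i2 := hm.const_mul ⟪w, g⟫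
  have i3 := (hin g).const_mul ⟪x, w⟫
  have i4 := (hin w).const_mul ⟪x, g⟫
  have j1 := int_sub' i0 i1
  have j2 := int_add' j1 i2
  have j3 := int_add' j2 i3
  have j4 := int_add' j3 i4
  rw [← integral_sub i0 i1, ← integral_add j1 i2, ← integral_add j2 i3, ← integral_add j3 i4,
    ← integral_sub j4 hsi]
  refine integral_congr_ae (Filter.Eventually.of_forall fun y => ?_)
  have e : ∑ i, ∑ j, w i * (y i * y j * u y) * g j = u y * (⟪w, y⟫ * ⟪g, y⟫) := by
    rw [real_inner_comm, real_inner_comm y g, euc_inner_sum, euc_inner_sum, Finset.sum_mul_sum,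
      Finset.mul_sum]
    refine Finset.sum_congr rfl fun i _ => ?_
    rw [Finset.mul_sum]
    exact Finset.sum_congr rfl fun j _ => by ring
  simp only
  rw [e, real_inner_smul_right, real_inner_comm, landauA_inner]
  simp only [inner_sub_left, real_inner_smul_right]
  rw [@norm_sub_sq_real, real_inner_comm w y, real_inner_comm g y]
  ring

end

/-- KL dissipation bound for the Landau equation with Maxwellian molecules:
`(d/dt) KL(u_t‖u*_t) ≤ 2 ∫ |∇log u − s|²_{A∗u} u + ∫ ⟨∇log u*, (Σ−Σ*)(∇log u − ∇log u*)⟩ u`. -/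
theorem landau_kl_dissipation_bound (d : ℕ) (hd : 1 ≤ d)
    (u ustar : ℝ → EuclideanSpace ℝ (Fin d) → ℝ) (t : ℝ)
    (hu : ContDiff ℝ 1 (u t)) (hustar : ContDiff ℝ 1 (ustar t))
    (hupos : ∀ x, 0 < u t x) (hustarpos : ∀ x, 0 < ustar t x)
    (hunorm : ∫ x, u t x = 1) (hustarnorm : ∫ x, ustar t x = 1)
    (humom : Integrable fun x => ‖x‖ ^ 2 * u t x)
    (hustarmom : Integrable fun x => ‖x‖ ^ 2 * ustar t x)
    -- equal means and equal energies
    (V : EuclideanSpace ℝ (Fin d))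
    (hVu : V = ∫ x, u t x • x) (hVustar : V = ∫ x, ustar t x • x)
    (twoE : ℝ)
    (hEu : twoE = ∫ x, ‖x‖ ^ 2 * u t x) (hEustar : twoE = ∫ x, ‖x‖ ^ 2 * ustar t x)
    -- second moment matrices
    (Smat Sstarmat : Fin d → Fin d → ℝ)
    (hSmat : ∀ i j, Smat i j = ∫ x, x i * x j * u t x)
    (hSstarmat : ∀ i j, Sstarmat i j = ∫ x, x i * x j * ustar t x)
    (s : EuclideanSpace ℝ (Fin d) → EuclideanSpace ℝ (Fin d))
    -- convolution matrices `D = A∗u`, `Dstar = A∗u*`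
    (D Dstar : EuclideanSpace ℝ (Fin d) → EuclideanSpace ℝ (Fin d) → EuclideanSpace ℝ (Fin d))
    (hD : ∀ x w, D x w = ∫ y, u t y • landauA d 0 (x - y) w)
    (hDstar : ∀ x w, Dstar x w = ∫ y, ustar t y • landauA d 0 (x - y) w)
    -- the three velocity fields
    (v vstar vbar : EuclideanSpace ℝ (Fin d) → EuclideanSpace ℝ (Fin d))
    (hv : ∀ x, v x = -∫ y, u t y • landauA d 0 (x - y) (s x - s y))
    (hvstar : ∀ x, vstar x
      = -∫ y, ustar t y • landauA d 0 (x - y) (score d (ustar t) x - score d (ustar t) y))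
    (hvbar : ∀ x, vbar x
      = -∫ y, u t y • landauA d 0 (x - y) (score d (u t) x - score d (u t) y))
    -- Fokker-Planck decompositions
    (hvstar_decomp : ∀ x, vstar x
      = -(((d : ℝ) - 1) • (x - V)) - Dstar x (score d (ustar t) x))
    (hvbar_decomp : ∀ x, vbar x
      = -(((d : ℝ) - 1) • (x - V)) - D x (score d (u t) x))
    -- the KL divergence and its derivative (dissipation formula)
    (KL : ℝ → ℝ)
    (hKL : ∀ τ, KL τ = ∫ x, u τ x * Real.log (u τ x / ustar τ x))
    (hderiv : HasDerivAt KL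
      (∫ x, ⟪v x - vstar x, score d (u t) x - score d (ustar t) x⟫ * u t x) t)
    -- absolute convergence of all integrals involved
    (hfin1 : Integrable fun x =>
      ⟪score d (u t) x - s x, D x (score d (u t) x - s x)⟫ * u t x)
    (hfin2 : Integrable fun x =>
      ⟪score d (u t) x - score d (ustar t) x,
        D x (score d (u t) x - score d (ustar t) x)⟫ * u t x)
    (hfin3 : Integrable fun x =>
      (∑ i, ∑ j, score d (ustar t) x i * (Smat i j - Sstarmat i j)
        * (score d (u t) x j - score d (ustar t) x j)) * u t x)
    (hLHS : Integrable fun x =>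
      ⟪v x - vstar x, score d (u t) x - score d (ustar t) x⟫ * u t x)
    (hv_int : ∀ x, Integrable fun y => u t y • landauA d 0 (x - y) (s x - s y))
    (hvbar_int : ∀ x, Integrable fun y =>
      u t y • landauA d 0 (x - y) (score d (u t) x - score d (u t) y))
    (hprod1 : Integrable
      (fun p : EuclideanSpace ℝ (Fin d) × EuclideanSpace ℝ (Fin d) =>
        u t p.1 * u t p.2 *
          ⟪score d (u t) p.2 - s p.2,
            landauA d 0 (p.1 - p.2) (score d (u t) p.2 - s p.2)⟫)
      (volume.prod volume))
    (hprod2 : Integrable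
      (fun p : EuclideanSpace ℝ (Fin d) × EuclideanSpace ℝ (Fin d) =>
        u t p.1 * u t p.2 *
          ⟪score d (u t) p.1 - score d (ustar t) p.1,
            landauA d 0 (p.1 - p.2) (score d (u t) p.1 - score d (ustar t) p.1)⟫)
      (volume.prod volume)) :
    deriv KL t
      ≤ 2 * (∫ x, ⟪score d (u t) x - s x, D x (score d (u t) x - s x)⟫ * u t x)
        + ∫ x, (∑ i, ∑ j, score d (ustar t) x i * (Smat i j - Sstarmat i j)
            * (score d (u t) x j - score d (ustar t) x j)) * u t x := by
  have hc := hu.continuous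
  have hi : Integrable (u t) := by
    by_contra h
    rw [integral_undef h] at hunorm; norm_num at hunorm
  have his : Integrable (ustar t) := by
    by_contra h
    rw [integral_undef h] at hustarnorm; norm_num at hustarnorm
  rw [hderiv.deriv]
  set a := score d (u t) with ha
  set b := score d (ustar t) with hb
  have hA := int_A hc hupos hi humom
  -- convolution difference
  have hdiff : ∀ x w g, ⟪Dstar x w - D x w, g⟫
      = ∑ i, ∑ j, w i * (Smat i j - Sstarmat i j) * g j := by
    intro x w g
    rw [inner_sub_left, hDstar, hD,
      moment hustar.continuous hustarpos his hustarnorm hustarmom,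
      moment hc hupos hi hunorm humom, ← hVu, ← hVustar, ← hEu, ← hEustar]
    simp only [← hSmat, ← hSstarmat, mul_sub, sub_mul, Finset.sum_sub_distrib]
    ring
  have hDin : ∀ x w g, ⟪D x w, g⟫ = ∫ y, u t y * ⟪landauA d 0 (x - y) w, g⟫ := by
    intro x w g
    rw [hD, real_inner_comm, ← integral_inner (hA x w)]
    refine integral_congr_ae (Filter.Eventually.of_forall fun y => ?_)
    simp only
    rw [real_inner_smul_right, real_inner_comm]
  have hAin : ∀ x w g, Integrable fun y => u t y * ⟪landauA d 0 (x - y) w, g⟫ := by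
    intro x w g
    refine ((hA x w).const_inner g).congr (Filter.Eventually.of_forall fun y => ?_)
    simp only
    rw [real_inner_smul_right, real_inner_comm]
  have hDpsd : ∀ x w, 0 ≤ ⟪D x w, w⟫ := fun x w => by
    rw [hDin]
    exact integral_nonneg fun y => mul_nonneg (hupos y).le (landauA_psd d _ _)
  set P : ℝ := ∫ x, ⟪a x - s x, D x (a x - s x)⟫ * u t x with hP
  have hPnn : 0 ≤ P := integral_nonneg fun x =>
    mul_nonneg (by rw [real_inner_comm]; exact hDpsd _ _) (hupos x).le
  let F : EuclideanSpace ℝ (Fin d) → ℝ := fun x =>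
    ∫ y, u t x * u t y * ⟪a y - s y, landauA d 0 (x - y) (a y - s y)⟫
  have hFint : Integrable F := hprod1.integral_prod_left
  have hFP : ∫ x, F x = P := by
    have h := integral_integral_swap (μ := volume) (ν := volume)
      (f := fun x y => u t x * u t y * ⟪a y - s y, landauA d 0 (x - y) (a y - s y)⟫) hprod1
    change ∫ x, ∫ y, _ = _
    rw [h, hP]
    refine integral_congr_ae (Filter.Eventually.of_forall fun y => ?_)
    simp only
    rw [real_inner_comm, hDin, ← integral_mul_const]
    refine integral_congr_ae (Filter.Eventually.of_forall fun x => ?_)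
    simp only
    rw [real_inner_comm, landauA_inner, landauA_inner, norm_sub_rev, ← neg_sub y x,
      inner_neg_left]
    ring
  set T : EuclideanSpace ℝ (Fin d) → ℝ := fun x =>
    (∑ i, ∑ j, b x i * (Smat i j - Sstarmat i j) * (a x j - b x j)) * u t x with hT
  have key : ∀ᵐ x, ⟪v x - vstar x, a x - b x⟫ * u t x
      ≤ (1/2) * (⟪a x - s x, D x (a x - s x)⟫ * u t x) + (1/2) * F x + T x := by
    filter_upwards [hprod1.prod_right_ae] with x hx
    have hux := hupos x
    set g := a x - b x with hg
    have hx' : Integrable fun y => u t y * ⟪landauA d 0 (x - y) (a y - s y), a y - s y⟫ := by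
      refine (hx.const_mul (u t x)⁻¹).congr (Filter.Eventually.of_forall fun y => ?_)
      simp only
      rw [real_inner_comm]
      field_simp
    have hFx : F x = u t x * ∫ y, u t y * ⟪landauA d 0 (x - y) (a y - s y), a y - s y⟫ := by
      rw [← integral_const_mul]
      refine integral_congr_ae (Filter.Eventually.of_forall fun y => ?_)
      simp only
      rw [real_inner_comm]; ring
    have hvv : v x - vbar x
        = ∫ y, u t y • landauA d 0 (x - y) ((a x - s x) - (a y - s y)) := by
      rw [hv, hvbar, neg_sub_neg, ← integral_sub (hvbar_int x) (hv_int x)]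
      refine integral_congr_ae (Filter.Eventually.of_forall fun y => ?_)
      simp only
      rw [← smul_sub, ← landauA_sub]
      congr 2
      abel
    have hvvi : Integrable fun y =>
        u t y • landauA d 0 (x - y) ((a x - s x) - (a y - s y)) := by
      refine ((hvbar_int x).sub (hv_int x)).congr (Filter.Eventually.of_forall fun y => ?_)
      simp only [Pi.sub_apply]
      rw [← smul_sub, ← landauA_sub]
      congr 2
      abel
    have h1 : ⟪v x - vbar x, g⟫ ≤ ⟪D x g, g⟫ + (1/2) * ⟪D x (a x - s x), a x - s x⟫
        + (1/2) * ∫ y, u t y * ⟪landauA d 0 (x - y) (a y - s y), a y - s y⟫ := by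
      rw [hvv, real_inner_comm, ← integral_inner hvvi, hDin, hDin, ← integral_const_mul,
        ← integral_const_mul, ← integral_add (hAin _ _ _) ((hAin _ _ _).const_mul _),
        ← integral_add (int_add' (hAin _ _ _) ((hAin _ _ _).const_mul _)) (hx'.const_mul _)]
      refine integral_mono (hvvi.const_inner g)
        (int_add' (int_add' (hAin _ _ _) ((hAin _ _ _).const_mul _)) (hx'.const_mul _)) fun y => ?_
      simp only
      rw [real_inner_smul_right, real_inner_comm]
      have := mul_le_mul_of_nonneg_left
        (landauA_young d (x - y) (a x - s x) (a y - s y) g) (hupos y).le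
      linarith
    have hDsub : D x (a x) - D x (b x) = D x g := by
      rw [hD, hD, hD, ← integral_sub (hA _ _) (hA _ _)]
      refine integral_congr_ae (Filter.Eventually.of_forall fun y => ?_)
      simp only
      rw [← smul_sub, ← landauA_sub]
    have h2 : v x - vstar x = (v x - vbar x) - D x g + (Dstar x (b x) - D x (b x)) := by
      rw [hvbar_decomp, hvstar_decomp, ← hDsub]; abel
    have h3 : ⟪v x - vstar x, g⟫ ≤ (1/2) * ⟪D x (a x - s x), a x - s x⟫
        + (1/2) * (∫ y, u t y * ⟪landauA d 0 (x - y) (a y - s y), a y - s y⟫)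
        + ∑ i, ∑ j, b x i * (Smat i j - Sstarmat i j) * (a x j - b x j) := by
      have h4 := hdiff x (b x) g
      have h5 : ∀ j, g j = a x j - b x j := fun j => rfl
      simp only [h5] at h4
      rw [h2, inner_add_left, inner_sub_left, h4]
      linarith
    have h6 := mul_le_mul_of_nonneg_right h3 hux.le
    rw [hFx, hT, real_inner_comm (D x (a x - s x)) (a x - s x)]
    simp only
    linarith
  have hmono := integral_mono_ae hLHS
    ((int_add' (hfin1.const_mul (1/2)) (hFint.const_mul (1/2))).add hfin3) key
  have hR : ∫ x, ((1/2) * (⟪a x - s x, D x (a x - s x)⟫ * u t x) + (1/2) * F x + T x)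
      = (1/2) * P + (1/2) * P + ∫ x, T x := by
    rw [integral_add (int_add' (hfin1.const_mul (1/2)) (hFint.const_mul (1/2))) hfin3,
      integral_add (hfin1.const_mul (1/2)) (hFint.const_mul (1/2)), integral_const_mul,
      integral_const_mul, hFP]
  have hmono' := hmono.trans_eq hR
  linarith
end
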